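/- arXiv:2303.14293 — 4 statements merged into one kernel-verified Lean document; each statement's English description precedes it below -/
import Mathlib

section
/- Let n ≥ 1 be a natural number, θ = 2^{1/n}, let 0 < β < n, V > 0, and let K, M, T be natural numbers with 2^K − 1 + M = T and 1 ≤ M ≤ 2^K. Then ∑_{i=0}^{K−1} 2^i · V^β · 2^{−iβ/n} + M · V^β · 2^{−Kβ/n} ≤ (θ^{n−β}/(θ^{n−β} − 1)) · V^β · T^{(n−β)/n}. -/
/-- With θ = 2^(1/n), 0 < β < n, V > 0, and 2^K − 1 + M = T, 1 ≤ M ≤ 2^K: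
∑_{i=0}^{K−1} 2^i·V^β·2^(−iβ/n) + M·V^β·2^(−Kβ/n)
  ≤ (θ^(n−β)/(θ^(n−β) − 1))·V^β·T^((n−β)/n). -/
theorem stmt_6 (n : ℕ) (hn : 1 ≤ n) (β V : ℝ) (hβ : 0 < β) (hβn : β < n) (hV : 0 < V)
    (K M T : ℕ) (hKMT : 2 ^ K - 1 + M = T) (hM1 : 1 ≤ M) (hM2 : M ≤ 2 ^ K) :
    ∑ i ∈ Finset.range K, (2 : ℝ) ^ i * V ^ β * (2 : ℝ) ^ (-((i : ℝ) * β) / n) +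
        (M : ℝ) * V ^ β * (2 : ℝ) ^ (-((K : ℝ) * β) / n) ≤
      ((2 : ℝ) ^ ((1 : ℝ) / n)) ^ ((n : ℝ) - β) /
          (((2 : ℝ) ^ ((1 : ℝ) / n)) ^ ((n : ℝ) - β) - 1) *
        V ^ β * (T : ℝ) ^ (((n : ℝ) - β) / n) := by
  have hn0 : (0 : ℝ) < n := by exact_mod_cast hn
  set s : ℝ := ((n : ℝ) - β) / n with hs
  have hs0 : 0 < s := div_pos (by linarith) hn0
  have hs1 : s ≤ 1 := by rw [hs, div_le_one hn0]; linarith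
  have hq : ((2 : ℝ) ^ ((1 : ℝ) / n)) ^ ((n : ℝ) - β) = (2 : ℝ) ^ s := by
    rw [← Real.rpow_mul (by norm_num)]
    congr 1
    rw [hs]; ring
  rw [hq]
  set q : ℝ := (2 : ℝ) ^ s with hqd
  have hq1 : 1 < q := Real.one_lt_rpow (by norm_num) hs0
  have key : ∀ i : ℕ, (2 : ℝ) ^ i * (2 : ℝ) ^ (-((i : ℝ) * β) / n) = q ^ i := by
    intro i
    rw [hqd, ← Real.rpow_natCast, ← Real.rpow_natCast, ← Real.rpow_mul (by norm_num),
      ← Real.rpow_add (by norm_num)]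
    congr 1
    rw [hs]; field_simp; ring
  have hVb : 0 < V ^ β := Real.rpow_pos_of_pos hV β
  have hsum : ∑ i ∈ Finset.range K, (2 : ℝ) ^ i * V ^ β * (2 : ℝ) ^ (-((i : ℝ) * β) / n)
      = V ^ β * ((q ^ K - 1) / (q - 1)) := by
    rw [← geom_sum_eq hq1.ne', Finset.mul_sum]
    refine Finset.sum_congr rfl fun i _ => ?_
    rw [← key i]; ring
  have hN : (0 : ℝ) < 2 ^ K := by positivity
  obtain ⟨m, hm⟩ : ∃ m : ℝ, m = (M : ℝ) / 2 ^ K := ⟨_, rfl⟩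
  have hMm : (M : ℝ) = 2 ^ K * m := by rw [hm]; field_simp
  have hm0 : 0 ≤ m := by rw [hm]; positivity
  have hm1 : m ≤ 1 := by
    rw [hm, div_le_one hN]; exact_mod_cast hM2
  have hT : (T : ℝ) + 1 = 2 ^ K * (1 + m) := by
    have h1 : 1 ≤ 2 ^ K := Nat.one_le_two_pow
    have h2 : T + 1 = 2 ^ K + M := by omega
    have h3 : (T : ℝ) + 1 = 2 ^ K + M := by exact_mod_cast h2
    rw [h3, hMm]; ring
  have hconc : 1 + (q - 1) * m ≤ (1 + m) ^ s := by
    have h := (Real.concaveOn_rpow hs0.le hs1).2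
      (show (1 : ℝ) ∈ Set.Ici 0 by simp) (show (2 : ℝ) ∈ Set.Ici 0 by simp)
      (show 0 ≤ 1 - m by linarith) hm0 (by ring)
    simp only [smul_eq_mul, Real.one_rpow] at h
    rw [← hqd, show (1 - m) * 1 + m * 2 = 1 + m by ring] at h
    linarith
  have hsub : ((T : ℝ) + 1) ^ s ≤ (T : ℝ) ^ s + 1 := by
    have h := Real.rpow_add_le_add_rpow (Nat.cast_nonneg T : (0 : ℝ) ≤ T) zero_le_one hs0.le hs1
    simpa using h
  have hNs : ((2 : ℝ) ^ K) ^ s = q ^ K := by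
    rw [hqd, ← Real.rpow_natCast, ← Real.rpow_natCast, ← Real.rpow_mul (by norm_num),
      ← Real.rpow_mul (by norm_num), mul_comm]
  rw [hT, Real.mul_rpow hN.le (by linarith), hNs] at hsub
  have hqK : 0 < q ^ K := by positivity
  have hTs : 0 ≤ (T : ℝ) ^ s := by positivity
  have hmain : q ^ K - 1 + (q - 1) * (m * q ^ K) ≤ q * (T : ℝ) ^ s := by
    have h1 := mul_le_mul_of_nonneg_left hconc hqK.le
    have h2 : (T : ℝ) ^ s ≤ q * (T : ℝ) ^ s := le_mul_of_one_le_left hTs hq1.le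
    nlinarith
  have hq0 : 0 < q - 1 := by linarith
  rw [hsum, hMm]
  calc _ = V ^ β * ((q ^ K - 1 + (q - 1) * (m * q ^ K)) / (q - 1)) := by
        rw [← key K]; field_simp
    _ ≤ V ^ β * ((q * (T : ℝ) ^ s) / (q - 1)) := by gcongr
    _ = _ := by ring
end

section
/- Let n ≥ 1 be a natural number, θ = 2^{1/n}, α ∈ (0,1), C > 0, V > 0, λ₀ > 0, T ≥ 1 a natural number, and set C₀ = λ₀·C·V^{α−1}·T^{(1−α)/n}. Then C₀·(θ^n/(θ^{n−1}−1))·V·T^{(n−1)/n} + C·(θ^{n−α}/(θ^{n−α}−1))·V^α·T^{(n−α)/n} + C₀^{α/(α−1)}·C^{−1/(α−1)}·T ≤ K_n · (1 + λ₀ + λ₀^{α/(α−1)}) · C · V^α · T^{(n−α)/n}, where K_n = max(θ^n/(θ^{n−1}−1), θ^{n−α}/(θ^{n−α}−1), 1). In particular, the cumulative regret bound C₀θ∑‖v_t‖ + C∑‖v_t‖^α + Tε₀ of the algorithm is O((1 + λ₀ + λ₀^{α/(α−1)})·C·V^α·T^{(n−α)/n}). -/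
/-- With θ = 2^(1/n) and C₀ = lam₀·C·V^(α−1)·T^((1−α)/n), the three regret
bound terms sum to at most K_n·(1 + lam₀ + lam₀^(α/(α−1)))·C·V^α·T^((n−α)/n), where
K_n = max(θ^n/(θ^(n−1)−1), θ^(n−α)/(θ^(n−α)−1), 1). -/
theorem stmt_8 (n : ℕ) (hn : 1 ≤ n) (α C V lam₀ : ℝ) (hα : 0 < α) (hα1 : α < 1)
    (hC : 0 < C) (hV : 0 < V) (hlam : 0 < lam₀) (T : ℕ) (hT : 1 ≤ T)
    (θ C₀ Kn : ℝ) (hθ : θ = (2 : ℝ) ^ ((1 : ℝ) / n))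
    (hC₀ : C₀ = lam₀ * C * V ^ (α - 1) * (T : ℝ) ^ ((1 - α) / n))
    (hKn : Kn = max (max (θ ^ (n : ℝ) / (θ ^ ((n : ℝ) - 1) - 1))
      (θ ^ ((n : ℝ) - α) / (θ ^ ((n : ℝ) - α) - 1))) 1) :
    C₀ * (θ ^ (n : ℝ) / (θ ^ ((n : ℝ) - 1) - 1)) * V * (T : ℝ) ^ (((n : ℝ) - 1) / n) +
        C * (θ ^ ((n : ℝ) - α) / (θ ^ ((n : ℝ) - α) - 1)) * V ^ α *
          (T : ℝ) ^ (((n : ℝ) - α) / n) +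
        C₀ ^ (α / (α - 1)) * C ^ (-1 / (α - 1)) * (T : ℝ) ≤
      Kn * (1 + lam₀ + lam₀ ^ (α / (α - 1))) * C * V ^ α * (T : ℝ) ^ (((n : ℝ) - α) / n) := by
  have hn0 : (n : ℝ) ≠ 0 := by positivity
  have hT0 : (0 : ℝ) < T := by exact_mod_cast hT
  have ha : α - 1 ≠ 0 := by linarith
  have hA : θ ^ (n : ℝ) / (θ ^ ((n : ℝ) - 1) - 1) ≤ Kn := by
    rw [hKn]; exact (le_max_left _ _).trans (le_max_left _ _)
  have hB : θ ^ ((n : ℝ) - α) / (θ ^ ((n : ℝ) - α) - 1) ≤ Kn := by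
    rw [hKn]; exact (le_max_right _ _).trans (le_max_left _ _)
  have h1 : 1 ≤ Kn := by rw [hKn]; exact le_max_right _ _
  clear hKn
  generalize θ ^ (n : ℝ) / (θ ^ ((n : ℝ) - 1) - 1) = A at *
  generalize θ ^ ((n : ℝ) - α) / (θ ^ ((n : ℝ) - α) - 1) = B at *
  have hVV : V ^ (α - 1) * V = V ^ α := by
    rw [← Real.rpow_add_one hV.ne']; congr 1; ring
  have hTT : (T : ℝ) ^ ((1 - α) / n) * (T : ℝ) ^ (((n : ℝ) - 1) / n)
      = (T : ℝ) ^ (((n : ℝ) - α) / n) := by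
    rw [← Real.rpow_add hT0]; congr 1; field_simp; ring
  have e1 : C₀ * A * V * (T : ℝ) ^ (((n : ℝ) - 1) / n)
      = (lam₀ * A) * (C * V ^ α * (T : ℝ) ^ (((n : ℝ) - α) / n)) := by
    rw [hC₀, ← hVV, ← hTT]; ring
  have hCC : C ^ (α / (α - 1)) * C ^ (-1 / (α - 1)) = C := by
    rw [← Real.rpow_add hC]
    have : α / (α - 1) + -1 / (α - 1) = 1 := by field_simp; ring
    rw [this, Real.rpow_one]
  have hV3 : (V ^ (α - 1)) ^ (α / (α - 1)) = V ^ α := by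
    rw [← Real.rpow_mul hV.le]; congr 1; field_simp
  have hT3 : ((T : ℝ) ^ ((1 - α) / n)) ^ (α / (α - 1)) * T
      = (T : ℝ) ^ (((n : ℝ) - α) / n) := by
    rw [← Real.rpow_mul hT0.le, ← Real.rpow_add_one hT0.ne']
    congr 1; field_simp; ring
  have e3 : C₀ ^ (α / (α - 1)) * C ^ (-1 / (α - 1)) * (T : ℝ)
      = lam₀ ^ (α / (α - 1)) * (C * V ^ α * (T : ℝ) ^ (((n : ℝ) - α) / n)) := by
    rw [hC₀, Real.mul_rpow (by positivity) (by positivity),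
      Real.mul_rpow (by positivity) (by positivity),
      Real.mul_rpow (by positivity) (by positivity), hV3, ← hT3]
    linear_combination (lam₀ ^ (α / (α - 1)) * V ^ α *
      (((T : ℝ) ^ ((1 - α) / n)) ^ (α / (α - 1)) * T)) * hCC
  rw [e1, e3]
  have hX : 0 < C * V ^ α * (T : ℝ) ^ (((n : ℝ) - α) / n) := by positivity
  have hL : 0 < lam₀ ^ (α / (α - 1)) := by positivity
  have key : lam₀ * A + B + lam₀ ^ (α / (α - 1)) ≤ Kn * (1 + lam₀ + lam₀ ^ (α / (α - 1))) := by
    nlinarith [mul_le_mul_of_nonneg_left hA hlam.le, mul_le_mul_of_nonneg_left h1 hL.le]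
  have := mul_le_mul_of_nonneg_right key hX.le
  linarith
end

section
/- Let α ∈ (0,1), C > 0, ε > 0, and x_* ∈ ℝ^n. Define f : ℝ^n → ℝ by f(x) = C·(‖x − x_*‖^α − ε^α) if ‖x − x_*‖ ≤ ε, and f(x) = 0 otherwise. Then f is Hölder continuous with exponent α and constant C, i.e., |f(x) − f(y)| ≤ C·‖x − y‖^α for all x, y ∈ ℝ^n. -/
lemma rpow_sub_aux (α a b d : ℝ) (hα : 0 < α) (hα1 : α < 1) (ha : 0 ≤ a) (hb : 0 ≤ b)
    (hd : 0 ≤ d) (h : a ≤ b + d) : a ^ α ≤ b ^ α + d ^ α := by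
  have h1 : a ^ α ≤ (b + d) ^ α := Real.rpow_le_rpow ha h hα.le
  have h2 := NNReal.rpow_add_le_add_rpow ⟨b, hb⟩ ⟨d, hd⟩ hα.le hα1.le
  have h3 : (b + d) ^ α ≤ b ^ α + d ^ α := by exact_mod_cast h2
  exact h1.trans h3

/-- The truncated Hölder cone
f(x) = C·(‖x − x_*‖^α − ε^α) for ‖x − x_*‖ ≤ ε and f(x) = 0 otherwise
is (C,α)-Hölder on all of ℝⁿ. -/
theorem stmt_10 (n : ℕ) (α C ε : ℝ) (hα : 0 < α) (hα1 : α < 1) (hC : 0 < C) (hε : 0 < ε)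
    (x_star : EuclideanSpace ℝ (Fin n)) (f : EuclideanSpace ℝ (Fin n) → ℝ)
    (hf : ∀ x, f x = if ‖x - x_star‖ ≤ ε then C * (‖x - x_star‖ ^ α - ε ^ α) else 0) :
    ∀ x y, |f x - f y| ≤ C * ‖x - y‖ ^ α := by
  have hf' : ∀ x, f x = C * ((min ‖x - x_star‖ ε) ^ α - ε ^ α) := by
    intro x
    rw [hf]
    split_ifs with h
    · rw [min_eq_left h]
    · rw [min_eq_right (not_le.mp h).le]; ring
  have key : ∀ x y, f x - f y ≤ C * ‖x - y‖ ^ α := by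
    intro x y
    have ht : ‖x - x_star‖ ≤ ‖y - x_star‖ + ‖x - y‖ := by
      have := norm_add_le (y - x_star) (x - y)
      rwa [show y - x_star + (x - y) = x - x_star by abel] at this
    have hm : min ‖x - x_star‖ ε ≤ min ‖y - x_star‖ ε + ‖x - y‖ := by
      have := norm_nonneg (x - y)
      rcases min_cases ‖y - x_star‖ ε with h | h
      · linarith [min_le_left ‖x - x_star‖ ε]
      · linarith [min_le_right ‖x - x_star‖ ε]
    have := rpow_sub_aux α _ _ _ hα hα1 (le_min (norm_nonneg _) hε.le)
      (le_min (norm_nonneg _) hε.le) (norm_nonneg _) hm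
    rw [hf', hf']
    have := mul_le_mul_of_nonneg_left this hC.le
    linarith
  intro x y
  rw [abs_le]
  have h := key y x
  rw [norm_sub_rev] at h
  exact ⟨by linarith, key x y⟩
end

section
/- Let n ≥ 1, α ∈ (0,1), C > 0, and let ω_n be the Lebesgue volume of the Euclidean unit ball in ℝ^n. For any points x_1, …, x_T ∈ [0,1]^n there exists a function f : [0,1]^n → ℝ that is Hölder continuous with exponent α and constant C such that ∑_{t=1}^T f(x_t) − T·min_{x∈[0,1]^n} f(x) ≥ C·ω_n^{−α/n}·T^{(n−α)/n}. Hence any (deterministic) global optimization algorithm has worst-case cumulative regret at least of order C·n^{α/2}·T^{(n−α)/n} over the class of (C,α)-Hölder functions on the unit cube, so the O(T^{(n−α)/n}) cumulative regret bound of the algorithm (with constant λ₀) is minimax optimal in T. -/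
open MeasureTheory


lemma cube_volume (n : ℕ) :
    volume {y : EuclideanSpace ℝ (Fin n) | ∀ i, y i ∈ Set.Icc (0 : ℝ) 1} = 1 := by
  have h := (EuclideanSpace.volume_preserving_symm_measurableEquiv_toLp (Fin n)).symm
  have h2 := h.symm.measure_preimage_equiv (Set.univ.pi fun _ : Fin n => Set.Icc (0:ℝ) 1)
  rw [MeasureTheory.volume_pi_pi] at h2
  simp only [Real.volume_Icc, sub_zero, ENNReal.ofReal_one, Finset.prod_const_one] at h2
  rw [← h2]
  congr 1
  ext y
  simp only [Set.mem_setOf_eq, Set.mem_preimage, Set.mem_univ_pi]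
  rfl

lemma cube_compact (n : ℕ) :
    IsCompact {y : EuclideanSpace ℝ (Fin n) | ∀ i, y i ∈ Set.Icc (0 : ℝ) 1} := by
  have h : IsCompact (Set.univ.pi fun _ : Fin n => Set.Icc (0:ℝ) 1) :=
    isCompact_univ_pi fun _ => isCompact_Icc
  have h2 := (EuclideanSpace.equiv (Fin n) ℝ).toHomeomorph.isCompact_preimage.2 h
  convert h2 using 1
  ext y
  simp only [Set.mem_setOf_eq, Set.mem_preimage, Set.mem_univ_pi]
  rfl

lemma exists_far (n T : ℕ) (hn : 1 ≤ n) (hT : 0 < T) (x : Fin T → EuclideanSpace ℝ (Fin n)) :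
    ∃ p ∈ {y : EuclideanSpace ℝ (Fin n) | ∀ i, y i ∈ Set.Icc (0 : ℝ) 1}, ∃ m : ℝ, 0 ≤ m ∧
      (∀ t, m ≤ ‖x t - p‖) ∧
      1 ≤ T * (m ^ n * (volume (Metric.ball (0 : EuclideanSpace ℝ (Fin n)) 1)).toReal) := by
  haveI : Nonempty (Fin T) := ⟨⟨0, hT⟩⟩
  obtain ⟨p, hp, hmax⟩ := (cube_compact n).exists_isMaxOn ⟨0, by intro i; simp⟩
    (Metric.continuous_infDist_pt (Set.range x)).continuousOn
  refine ⟨p, hp, Metric.infDist p (Set.range x), Metric.infDist_nonneg, fun t => ?_, ?_⟩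
  · rw [← dist_eq_norm, dist_comm]
    exact Metric.infDist_le_dist_of_mem ⟨t, rfl⟩
  · set m := Metric.infDist p (Set.range x) with hm
    have hm0 : 0 ≤ m := Metric.infDist_nonneg
    have hsub : {y : EuclideanSpace ℝ (Fin n) | ∀ i, y i ∈ Set.Icc (0 : ℝ) 1} ⊆
        ⋃ t, Metric.closedBall (x t) m := by
      intro y hy
      obtain ⟨_, ⟨t, rfl⟩, ht⟩ :=
        (Set.finite_range x).isCompact.exists_infDist_eq_dist (Set.range_nonempty x) y
      rw [Set.mem_iUnion]
      refine ⟨t, ?_⟩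
      rw [Metric.mem_closedBall, ← ht]
      exact hmax hy
    have h1 := (measure_mono (μ := volume) hsub).trans (measure_iUnion_le _)
    rw [cube_volume, tsum_fintype] at h1
    simp only [Measure.addHaar_closedBall _ _ hm0, finrank_euclideanSpace, Fintype.card_fin,
      Finset.sum_const, Finset.card_univ, nsmul_eq_mul] at h1
    have h2 := ENNReal.toReal_mono (ENNReal.mul_ne_top (by simp)
      (ENNReal.mul_ne_top (by simp) measure_ball_lt_top.ne)) h1
    simpa [ENNReal.toReal_mul, ENNReal.toReal_ofReal, hm0] using h2

lemma rpow_sub_le {a b d α : ℝ} (ha : 0 ≤ a) (hb : 0 ≤ b) (hd : 0 ≤ d) (h : a ≤ d + b)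
    (hα : 0 < α) (hα1 : α < 1) : a ^ α - b ^ α ≤ d ^ α := by
  have h1 := Real.rpow_le_rpow ha h hα.le
  have h2 := Real.rpow_add_le_add_rpow hd hb hα.le hα1.le
  linarith

/-- For any queries x_1,…,x_T in the unit cube there is a (C,α)-Hölder
function f on the cube whose cumulative regret ∑ f(x_t) − T·min f is at least
C·ω_n^(−α/n)·T^((n−α)/n), where ω_n is the volume of the Euclidean unit ball; hence the
O(T^((n−α)/n)) cumulative regret bound is minimax optimal in T. -/
theorem stmt_12 (n : ℕ) (hn : 1 ≤ n) (α C : ℝ) (hα : 0 < α) (hα1 : α < 1) (hC : 0 < C)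
    (T : ℕ) (x : Fin T → EuclideanSpace ℝ (Fin n))
    (hx : ∀ t, ∀ i, x t i ∈ Set.Icc (0 : ℝ) 1) :
    ∃ f : EuclideanSpace ℝ (Fin n) → ℝ,
      (∀ y ∈ {y : EuclideanSpace ℝ (Fin n) | ∀ i, y i ∈ Set.Icc (0 : ℝ) 1},
        ∀ z ∈ {y : EuclideanSpace ℝ (Fin n) | ∀ i, y i ∈ Set.Icc (0 : ℝ) 1},
        |f y - f z| ≤ C * ‖y - z‖ ^ α) ∧
      C * (volume (Metric.ball (0 : EuclideanSpace ℝ (Fin n)) 1)).toReal ^ (-α / n) *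
          (T : ℝ) ^ (((n : ℝ) - α) / n) ≤
        ∑ t, f (x t) -
          T * sInf (f '' {y : EuclideanSpace ℝ (Fin n) | ∀ i, y i ∈ Set.Icc (0 : ℝ) 1}) := by
  classical
  rcases Nat.eq_zero_or_pos T with rfl | hT
  · refine ⟨fun _ => 0, fun y _ z _ => ?_, ?_⟩
    · simp only [sub_zero, abs_zero]
      positivity
    · have hn' : (1:ℝ) ≤ n := by exact_mod_cast hn
      have : ((n:ℝ) - α) / n ≠ 0 := by
        apply ne_of_gt
        apply div_pos <;> linarith
      simp [Real.zero_rpow this]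
  obtain ⟨p, hp, m, hm0, hm, hvol⟩ := exists_far n T hn hT x
  refine ⟨fun y => C * ‖y - p‖ ^ α, fun y _ z _ => ?_, ?_⟩
  · simp only
    rw [← mul_sub, abs_mul, abs_of_pos hC]
    gcongr
    rw [abs_sub_le_iff]
    constructor
    · refine rpow_sub_le (norm_nonneg _) (norm_nonneg _) (norm_nonneg _) ?_ hα hα1
      simpa using norm_add_le (y - z) (z - p)
    · refine rpow_sub_le (norm_nonneg _) (norm_nonneg _) (norm_nonneg _) ?_ hα hα1
      rw [norm_sub_rev y z]
      simpa using norm_add_le (z - y) (y - p)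
  · set ω := (volume (Metric.ball (0 : EuclideanSpace ℝ (Fin n)) 1)).toReal with hω
    have hω0 : 0 < ω := ENNReal.toReal_pos
      (Metric.measure_ball_pos _ _ one_pos).ne' measure_ball_lt_top.ne
    have hT' : (0:ℝ) < T := by exact_mod_cast hT
    have hn' : (0:ℝ) < n := by exact_mod_cast hn
    have hinf : sInf ((fun y => C * ‖y - p‖ ^ α) ''
        {y : EuclideanSpace ℝ (Fin n) | ∀ i, y i ∈ Set.Icc (0 : ℝ) 1}) ≤ 0 := by
      apply csInf_le
      · refine ⟨0, ?_⟩
        rintro _ ⟨y, _, rfl⟩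
        positivity
      · exact ⟨p, hp, by simp [Real.zero_rpow hα.ne']⟩
    have hsum : (T:ℝ) * (C * m ^ α) ≤ ∑ t, C * ‖x t - p‖ ^ α := by
      have : ∑ _t : Fin T, C * m ^ α ≤ ∑ t, C * ‖x t - p‖ ^ α := by
        apply Finset.sum_le_sum
        intro t _
        have := hm t
        gcongr
      simpa using this
    have hmα : (ω * T) ^ (-α / n) ≤ m ^ α := by
      have h1 : (ω * T)⁻¹ ≤ m ^ n := by
        rw [inv_le_iff_one_le_mul₀ (by positivity)]
        linarith
      have h2 := Real.rpow_le_rpow (by positivity) h1 (div_pos hα hn').le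
      rw [Real.inv_rpow (by positivity), ← Real.rpow_neg (by positivity), ← Real.rpow_natCast,
        ← Real.rpow_mul hm0, mul_div_cancel₀ _ hn'.ne'] at h2
      rwa [neg_div]
    have hTe : (T:ℝ) ^ (((n : ℝ) - α) / n) = T * T ^ (-α / n) := by
      rw [← Real.rpow_one_add' hT'.le]
      · congr 1
        field_simp
        ring
      · have : 1 + -α / n = (n - α) / n := by
          field_simp
          ring
        rw [this]
        have : (1:ℝ) ≤ n := by exact_mod_cast hn
        exact (div_pos (by linarith) hn').ne'
    rw [Real.mul_rpow hω0.le hT'.le] at hmα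
    have h3 : (T:ℝ) * (C * (ω ^ (-α / n) * T ^ (-α / n))) ≤ T * (C * m ^ α) := by gcongr
    have h4 := mul_nonpos_of_nonneg_of_nonpos hT'.le hinf
    rw [hTe]
    simp only
    linarith
end
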